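/- arXiv:0711.1734 — 4 statements merged into one kernel-verified Lean document; each statement's English description precedes it below -/
import Mathlib

section
/- Let Φ : T → T' be a triangulated (exact) functor, and let T = ⟨A_1, …, A_m⟩ and T' = ⟨A'_1, …, A'_m⟩ be semiorthogonal decompositions such that Φ(A_i) ⊂ A'_i for all 1 ≤ i ≤ m. Then Φ commutes with the projection functors: there are functorial isomorphisms Φ ∘ α_i ≅ α'_i ∘ Φ for every i, where α_i and α'_i are the projection functors of the two decompositions. -/
/-!
STATEMENT 3:
Let `Φ : T → T'` be a triangulated (exact) functor, and let `T = ⟨A_1, …, A_m⟩` and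
`T' = ⟨A'_1, …, A'_m⟩` be semiorthogonal decompositions such that `Φ(A_i) ⊆ A'_i` for all
`1 ≤ i ≤ m`. Then `Φ` commutes with the projection functors: there are functorial
isomorphisms `Φ ∘ α_i ≅ α'_i ∘ Φ` for every `i`, where `α_i` and `α'_i` are the projection
functors of the two decompositions.

The projection functor data of a semiorthogonal decomposition is recorded as a functorial
chain `0 = X_m → … → X_0 = X` (functors `obj k` with `obj 0 ≅ 𝟭`, `obj m` pointwise zero)
together with functorial distinguished triangles `X_{k+1} → X_k → α_k X → X_{k+1}[1]`
whose third terms `α_k X` lie in `A_k`.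
-/

open CategoryTheory CategoryTheory.Limits CategoryTheory.Pretriangulated ZeroObject

universe v u v' u'

section Defs

variable {C : Type u} [Category.{v} C] [Preadditive C] [HasZeroObject C]
  [HasShift C ℤ] [∀ n : ℤ, (shiftFunctor C n).Additive] [Pretriangulated C]

/-- A strictly full triangulated subcategory: contains a zero object, closed under
isomorphisms, shifts and extensions. -/
structure IsTriangulatedSub (S : Set C) : Prop where
  zero_mem : (0 : C) ∈ S
  iso_closed : ∀ {X Y : C}, (X ≅ Y) → X ∈ S → Y ∈ S
  shift_mem : ∀ X ∈ S, ∀ n : ℤ, X⟦n⟧ ∈ S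
  ext₂ : ∀ (T : Triangle C), (T ∈ distTriang C) → T.obj₁ ∈ S → T.obj₃ ∈ S → T.obj₂ ∈ S

/-- A semiorthogonal decomposition `T = ⟨A 0, …, A (m-1)⟩`. -/
structure IsSOD (m : ℕ) (A : Fin m → Set C) : Prop where
  sub : ∀ i, IsTriangulatedSub (A i)
  semiorth : ∀ i j : Fin m, i < j → ∀ X ∈ A i, ∀ Y ∈ A j, ∀ k : ℤ, ∀ f : Y⟦k⟧ ⟶ X, f = 0
  filtration : ∀ X : C, ∃ (obj : Fin (m + 1) → C)
      (map : ∀ k : Fin m, obj k.succ ⟶ obj k.castSucc),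
      IsZero (obj (Fin.last m)) ∧ obj 0 = X ∧
      ∀ k : Fin m, ∃ Z ∈ A k, ∃ (g : obj k.castSucc ⟶ Z) (h : Z ⟶ (obj k.succ)⟦(1 : ℤ)⟧),
        (Triangle.mk (map k) g h ∈ distTriang C)

/-- The projection functors `proj k = α_k` of a semiorthogonal decomposition, together with
the functorial chain and the functorial distinguished triangles defining them.  This is
exactly the (functorial) filtration `0 = X_m → … → X_0 = X` with functorial distinguished
triangles `X_{k+1} → X_k → α_k X → X_{k+1}[1]` and `α_k X ∈ A k`. -/
structure ProjectionData (m : ℕ) (A : Fin m → Set C) where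
  obj : Fin (m + 1) → C ⥤ C
  proj : Fin m → C ⥤ C
  objZeroIso : obj 0 ≅ 𝟭 C
  isZero_last : ∀ X : C, IsZero ((obj (Fin.last m)).obj X)
  map : ∀ k : Fin m, obj k.succ ⟶ obj k.castSucc
  g : ∀ k : Fin m, obj k.castSucc ⟶ proj k
  h : ∀ k : Fin m, proj k ⟶ obj k.succ ⋙ shiftFunctor C (1 : ℤ)
  proj_mem : ∀ (k : Fin m) (X : C), (proj k).obj X ∈ A k
  distinguished : ∀ (k : Fin m) (X : C),
    (Triangle.mk ((map k).app X) ((g k).app X) ((h k).app X) ∈ distTriang C)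

end Defs

variable {C : Type u} [Category.{v} C] [Preadditive C] [HasZeroObject C]
  [HasShift C ℤ] [∀ n : ℤ, (shiftFunctor C n).Additive] [Pretriangulated C]
  {D : Type u'} [Category.{v'} D] [Preadditive D] [HasZeroObject D]
  [HasShift D ℤ] [∀ n : ℤ, (shiftFunctor D n).Additive] [Pretriangulated D]

/-- `Y` has no nonzero morphisms from any of its shifts to an object of `S`. -/
def LeftOrthogonal (S : Set D) (Y : D) : Prop :=
  ∀ Z ∈ S, ∀ n : ℤ, ∀ f : Y⟦n⟧ ⟶ Z, f = 0

lemma LeftOrthogonal.eq_zero {S : Set D} {Y Z : D} (hY : LeftOrthogonal S Y) (hZ : Z ∈ S)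
    (f : Y ⟶ Z) : f = 0 := by
  have h := hY Z hZ 0 ((shiftFunctorZero D ℤ).hom.app Y ≫ f)
  rwa [← cancel_epi ((shiftFunctorZero D ℤ).hom.app Y), comp_zero]

lemma LeftOrthogonal.of_isZero (S : Set D) {Y : D} (hY : IsZero Y) : LeftOrthogonal S Y :=
  fun _ _ n _ => ((shiftFunctor D n).map_isZero hY).eq_of_src _ _

lemma LeftOrthogonal.ext₂ {S : Set D} (T : Triangle D) (hT : T ∈ distTriang D)
    (h₁ : LeftOrthogonal S T.obj₁) (h₃ : LeftOrthogonal S T.obj₃) :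
    LeftOrthogonal S T.obj₂ := by
  intro Z hZ n f
  obtain ⟨g, hg⟩ := Triangle.yoneda_exact₂ _ (Triangle.shift_distinguished T hT n) f
    (h₁ Z hZ n _)
  rw [hg, h₃ Z hZ n g]
  exact comp_zero

/-- The steps of a filtration are left orthogonal to the components already split off. -/
lemma IsSOD.leftOrthogonal_of_filtration {m : ℕ} {A : Fin m → Set D} (hA : IsSOD m A)
    (obj : Fin (m + 1) → D) (hlast : IsZero (obj (Fin.last m)))
    (hobj : ∀ k : Fin m, ∃ T ∈ distTriang D,
      T.obj₁ = obj k.succ ∧ T.obj₂ = obj k.castSucc ∧ T.obj₃ ∈ A k)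
    (k : Fin (m + 1)) (i : Fin m) (hik : i.castSucc < k) :
    LeftOrthogonal (A i) (obj k) := by
  induction k using Fin.reverseInduction with
  | last => exact .of_isZero _ hlast
  | cast k ih =>
    obtain ⟨T, hT, h₁, h₂, h₃⟩ := hobj k
    rw [← h₂]
    refine .ext₂ T hT ?_ fun Z hZ n f => hA.semiorth i k (by simpa using hik) Z hZ _ h₃ n f
    rw [h₁]
    exact ih (hik.trans Fin.castSucc_lt_succ)

section Triangles

variable {S : Set D} {T T' : Triangle D}

lemma LeftOrthogonal.hom₁_ext (hT' : T' ∈ distTriang D) {Y : D} (hY : LeftOrthogonal S Y)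
    (h₃ : T'.obj₃ ∈ S) {a b : Y ⟶ T'.obj₁} (h : a ≫ T'.mor₁ = b ≫ T'.mor₁) : a = b := by
  rw [← sub_eq_zero]
  apply (shiftFunctor D (1 : ℤ)).map_injective
  obtain ⟨g, hg⟩ := Triangle.coyoneda_exact₁ _ hT' ((a - b)⟦(1 : ℤ)⟧')
    (by rw [← Functor.map_comp, Preadditive.sub_comp, h, sub_self, Functor.map_zero])
  rw [hg, hY _ h₃ 1 g, zero_comp, Functor.map_zero]

lemma LeftOrthogonal.hom₃_ext (hT : T ∈ distTriang D) (h₁ : LeftOrthogonal S T.obj₁)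
    {Z : D} (hZ : Z ∈ S) {a b : T.obj₃ ⟶ Z} (h : T.mor₂ ≫ a = T.mor₂ ≫ b) : a = b := by
  rw [← sub_eq_zero]
  obtain ⟨g, hg⟩ := Triangle.yoneda_exact₃ _ hT (a - b)
    (by rw [Preadditive.comp_sub, h, sub_self])
  rw [hg, h₁ _ hZ 1 g, comp_zero]

end Triangles

/-- Functors `F₁ ⟶ F₂ ⟶ F₃` completing pointwise to distinguished triangles, with `F₁`
left orthogonal to `S` and `F₃` taking values in `S`. -/
structure IsOrthogonalTruncation (S : Set D) {F₁ F₂ F₃ : C ⥤ D}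
    (a : F₁ ⟶ F₂) (b : F₂ ⟶ F₃) : Prop where
  orth : ∀ X, LeftOrthogonal S (F₁.obj X)
  mem : ∀ X, F₃.obj X ∈ S
  dist : ∀ X, ∃ c : F₃.obj X ⟶ (F₁.obj X)⟦(1 : ℤ)⟧,
    Triangle.mk (a.app X) (b.app X) c ∈ distTriang D

namespace IsOrthogonalTruncation

variable {S : Set D} {F₁ F₂ F₃ G₁ G₂ G₃ : C ⥤ D} {a : F₁ ⟶ F₂} {b : F₂ ⟶ F₃}
  {a' : G₁ ⟶ G₂} {b' : G₂ ⟶ G₃}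

lemma hom₁_ext (hG : IsOrthogonalTruncation S a' b') {Y : D} (hY : LeftOrthogonal S Y) {X : C}
    {s t : Y ⟶ G₁.obj X} (h : s ≫ a'.app X = t ≫ a'.app X) : s = t := by
  obtain ⟨c, hc⟩ := hG.dist X
  exact LeftOrthogonal.hom₁_ext hc hY (hG.mem X) h

lemma hom₃_ext (hF : IsOrthogonalTruncation S a b) {Z : D} (hZ : Z ∈ S) {X : C}
    {s t : F₃.obj X ⟶ Z} (h : b.app X ≫ s = b.app X ≫ t) : s = t := by
  obtain ⟨c, hc⟩ := hF.dist X
  exact LeftOrthogonal.hom₃_ext hc (hF.orth X) hZ h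

lemma exists_natTrans₁ (hF : IsOrthogonalTruncation S a b)
    (hG : IsOrthogonalTruncation S a' b') (e : F₂ ⟶ G₂) :
    ∃ t : F₁ ⟶ G₁, t ≫ a' = a ≫ e := by
  have h (X : C) : ∃ t : F₁.obj X ⟶ G₁.obj X, t ≫ a'.app X = a.app X ≫ e.app X := by
    obtain ⟨c, hc⟩ := hG.dist X
    obtain ⟨t, ht⟩ := Triangle.coyoneda_exact₂ _ hc (a.app X ≫ e.app X)
      ((hF.orth X).eq_zero (hG.mem X) _)
    exact ⟨t, ht.symm⟩
  choose t ht using h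
  exact ⟨{ app := t
           naturality := fun X Y f => hG.hom₁_ext (hF.orth X) (by simp [ht, reassoc_of% ht]) },
    by ext X; exact ht X⟩

lemma exists_natTrans₃ (hF : IsOrthogonalTruncation S a b)
    (hG : IsOrthogonalTruncation S a' b') (e : F₂ ⟶ G₂) :
    ∃ t : F₃ ⟶ G₃, b ≫ t = e ≫ b' := by
  have h (X : C) : ∃ t : F₃.obj X ⟶ G₃.obj X, b.app X ≫ t = e.app X ≫ b'.app X := by
    obtain ⟨c, hc⟩ := hF.dist X
    obtain ⟨t, ht⟩ := Triangle.yoneda_exact₂ _ hc (e.app X ≫ b'.app X)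
      ((hF.orth X).eq_zero (hG.mem X) _)
    exact ⟨t, ht.symm⟩
  choose t ht using h
  refine ⟨{ app := t
            naturality := fun X Y f => hF.hom₃_ext (hG.mem Y) ?_ }, by ext X; exact ht X⟩
  rw [← NatTrans.naturality_assoc, ht, reassoc_of% ht, NatTrans.naturality_assoc,
    NatTrans.naturality]

lemma natTrans₁_ext (hG : IsOrthogonalTruncation S a' b') {F : C ⥤ D}
    (hF : ∀ X, LeftOrthogonal S (F.obj X)) {s t : F ⟶ G₁} (h : s ≫ a' = t ≫ a') : s = t := by
  ext X
  exact hG.hom₁_ext (hF X) (NatTrans.congr_app h X)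

lemma natTrans₃_ext (hF : IsOrthogonalTruncation S a b) {G : C ⥤ D}
    (hG : ∀ X, G.obj X ∈ S) {s t : F₃ ⟶ G} (h : b ≫ s = b ≫ t) : s = t := by
  ext X
  exact hF.hom₃_ext (hG X) (NatTrans.congr_app h X)

lemma nonempty_iso₁ (hF : IsOrthogonalTruncation S a b)
    (hG : IsOrthogonalTruncation S a' b') (e : F₂ ≅ G₂) : Nonempty (F₁ ≅ G₁) := by
  obtain ⟨s, hs⟩ := exists_natTrans₁ hF hG e.hom
  obtain ⟨t, ht⟩ := exists_natTrans₁ hG hF e.inv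
  exact ⟨⟨s, t, natTrans₁_ext hF hF.orth (by simp [ht, reassoc_of% hs]),
    natTrans₁_ext hG hG.orth (by simp [hs, reassoc_of% ht])⟩⟩

lemma nonempty_iso₃ (hF : IsOrthogonalTruncation S a b)
    (hG : IsOrthogonalTruncation S a' b') (e : F₂ ≅ G₂) : Nonempty (F₃ ≅ G₃) := by
  obtain ⟨s, hs⟩ := exists_natTrans₃ hF hG e.hom
  obtain ⟨t, ht⟩ := exists_natTrans₃ hG hF e.inv
  exact ⟨⟨s, t, natTrans₃_ext hF hF.mem (by simp [ht, reassoc_of% hs]),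
    natTrans₃_ext hG hG.mem (by simp [hs, reassoc_of% ht])⟩⟩

end IsOrthogonalTruncation

namespace ProjectionData

lemma isOrthogonalTruncation_comp {m : ℕ} {A : Fin m → Set C} {A' : Fin m → Set D}
    (P : ProjectionData m A) (hA' : IsSOD m A') (Φ : C ⥤ D) [Φ.CommShift ℤ] [Φ.IsTriangulated]
    (hcompat : ∀ i : Fin m, ∀ X ∈ A i, Φ.obj X ∈ A' i) (k : Fin m) :
    IsOrthogonalTruncation (A' k) (Functor.whiskerRight (P.map k) Φ)
      (Functor.whiskerRight (P.g k) Φ) where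
  orth X := by
    refine hA'.leftOrthogonal_of_filtration (fun j => Φ.obj ((P.obj j).obj X))
      (Φ.map_isZero (P.isZero_last X)) (fun j => ?_) k.succ k Fin.castSucc_lt_succ
    exact ⟨_, Φ.map_distinguished _ (P.distinguished j X), rfl, rfl,
      hcompat j _ (P.proj_mem j X)⟩
  mem X := hcompat k _ (P.proj_mem k X)
  dist X := ⟨_, Φ.map_distinguished _ (P.distinguished k X)⟩

lemma isOrthogonalTruncation_precomp {m : ℕ} {A' : Fin m → Set D}
    (P' : ProjectionData m A') (hA' : IsSOD m A') (Φ : C ⥤ D) (k : Fin m) :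
    IsOrthogonalTruncation (A' k) (Functor.whiskerLeft Φ (P'.map k))
      (Functor.whiskerLeft Φ (P'.g k)) where
  orth X := by
    refine hA'.leftOrthogonal_of_filtration (fun j => (P'.obj j).obj (Φ.obj X))
      (P'.isZero_last _) (fun j => ?_) k.succ k Fin.castSucc_lt_succ
    exact ⟨_, P'.distinguished j (Φ.obj X), rfl, rfl, P'.proj_mem j _⟩
  mem X := P'.proj_mem k _
  dist X := ⟨_, P'.distinguished k (Φ.obj X)⟩

end ProjectionData

theorem compat_functor_commutes_with_projections
    (m : ℕ) (A : Fin m → Set C) (A' : Fin m → Set D)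
    (hA : IsSOD m A) (hA' : IsSOD m A')
    (P : ProjectionData m A) (P' : ProjectionData m A')
    (Φ : C ⥤ D) [Φ.CommShift ℤ] [Φ.IsTriangulated]
    (hcompat : ∀ i : Fin m, ∀ X ∈ A i, Φ.obj X ∈ A' i) :
    ∀ i : Fin m, Nonempty (P.proj i ⋙ Φ ≅ Φ ⋙ P'.proj i) := by
  have hP := P.isOrthogonalTruncation_comp hA' Φ hcompat
  have hP' := P'.isOrthogonalTruncation_precomp hA' Φ
  have key (k : Fin (m + 1)) : Nonempty (P.obj k ⋙ Φ ≅ Φ ⋙ P'.obj k) := by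
    induction k using Fin.induction with
    | zero =>
      exact ⟨Functor.isoWhiskerRight P.objZeroIso Φ ≪≫ Φ.leftUnitor ≪≫ Φ.rightUnitor.symm ≪≫
        Functor.isoWhiskerLeft Φ P'.objZeroIso.symm⟩
    | succ k ih =>
      obtain ⟨e⟩ := ih
      exact (hP k).nonempty_iso₁ (hP' k) e
  intro i
  obtain ⟨e⟩ := key i.castSucc
  exact (hP i).nonempty_iso₃ (hP' i) e
end

section
/- Let Φ : T → T' be a fully faithful triangulated functor and let T' = ⟨A'_1, …, A'_m⟩ be a semiorthogonal decomposition. Then there exists at most one semiorthogonal decomposition T = ⟨A_1, …, A_m⟩ compatible with Φ (i.e. such that Φ(A_i) ⊂ A'_i for all i), and if it exists its components are necessarily given by the preimages A_i = Φ^{-1}(A'_i) = {X ∈ T : Φ(X) ∈ A'_i}. -/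
/-!
STATEMENT 5:
Let `Φ : T → T'` be a fully faithful triangulated functor and let `T' = ⟨A'_1, …, A'_m⟩` be a
semiorthogonal decomposition. Then there exists at most one semiorthogonal decomposition
`T = ⟨A_1, …, A_m⟩` compatible with `Φ` (i.e. such that `Φ(A_i) ⊆ A'_i` for all `i`), and if
it exists its components are necessarily given by the preimages
`A_i = Φ⁻¹(A'_i) = {X ∈ T : Φ(X) ∈ A'_i}`.
-/

open CategoryTheory CategoryTheory.Limits CategoryTheory.Pretriangulated ZeroObject

universe v u v' u'

theorem hom_eq_zero_of_shift_zero {C : Type u} [Category.{v} C] [Preadditive C] [HasShift C ℤ]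
    {X Y : C} (h : ∀ f : X⟦(0 : ℤ)⟧ ⟶ Y, f = 0) (f : X ⟶ Y) : f = 0 := by
  have := h ((shiftFunctorZero C ℤ).hom.app X ≫ f)
  rwa [← cancel_epi ((shiftFunctorZero C ℤ).hom.app X), comp_zero]

section Orthogonality

variable {C : Type u} [Category.{v} C] [Preadditive C] [HasZeroObject C]
  [HasShift C ℤ] [∀ n : ℤ, (shiftFunctor C n).Additive] [Pretriangulated C]

/-- If all shifted morphisms to `W` from the outer terms of a distinguished triangle vanish,
then so do those from the middle term. -/
theorem shift_hom_eq_zero_of_distTriang {T : Triangle C} (hT : T ∈ distTriang C) {W : C} (n : ℤ)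
    (h₁ : ∀ f : T.obj₁⟦n⟧ ⟶ W, f = 0) (h₃ : ∀ f : T.obj₃⟦n⟧ ⟶ W, f = 0)
    (f : T.obj₂⟦n⟧ ⟶ W) : f = 0 := by
  obtain ⟨g, hg⟩ := Triangle.yoneda_exact₂ _ (Triangle.shift_distinguished T hT n) f (h₁ _)
  rw [hg, h₃ g]
  exact comp_zero

/-- The `k`-th object of a filtration with subquotients in `A j` is left orthogonal to
everything to which all `A j` with `k ≤ j` are left orthogonal. -/
theorem filtration_hom_eq_zero {m : ℕ} {A : Fin m → Set C} {obj : Fin (m + 1) → C}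
    {map : ∀ k : Fin m, obj k.succ ⟶ obj k.castSucc} (hlast : IsZero (obj (Fin.last m)))
    (hmap : ∀ k : Fin m, ∃ Z ∈ A k, ∃ (g : obj k.castSucc ⟶ Z)
      (h : Z ⟶ (obj k.succ)⟦(1 : ℤ)⟧), Triangle.mk (map k) g h ∈ distTriang C)
    {W : C} (k : Fin (m + 1))
    (hW : ∀ j : Fin m, k ≤ j.castSucc → ∀ Y ∈ A j, ∀ n : ℤ, ∀ f : Y⟦n⟧ ⟶ W, f = 0)
    (n : ℤ) (f : (obj k)⟦n⟧ ⟶ W) : f = 0 := by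
  induction k using Fin.reverseInduction with
  | last => exact ((shiftFunctor C n).map_isZero hlast).eq_of_src _ _
  | cast k ih =>
    obtain ⟨Z, hZ, g, h, hT⟩ := hmap k
    exact shift_hom_eq_zero_of_distTriang hT n
      (ih fun j hj => hW j (Fin.castSucc_lt_succ.le.trans hj))
      (hW k le_rfl Z hZ n) f

/-- In a semiorthogonal decomposition, an object which is right orthogonal to the components
above `i` and left orthogonal to the components below `i` lies in the `i`-th component. -/
theorem IsSOD.mem_of_orthogonal {m : ℕ} {A : Fin m → Set C} (hA : IsSOD m A) (i : Fin m) {X : C}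
    (hgt : ∀ j, i < j → ∀ Y ∈ A j, ∀ n : ℤ, ∀ f : Y⟦n⟧ ⟶ X, f = 0)
    (hlt : ∀ j, j < i → ∀ Y ∈ A j, ∀ n : ℤ, ∀ f : X⟦n⟧ ⟶ Y, f = 0) : X ∈ A i := by
  obtain ⟨obj, map, hlast, h0, hmap⟩ := hA.filtration X
  have hvan (k : Fin m) {W : C} (hW : W ∈ A k) (f : (obj k.succ)⟦(1 : ℤ)⟧ ⟶ W) : f = 0 :=
    filtration_hom_eq_zero hlast hmap k.succ
      (fun j hj Y hY n f => hA.semiorth k j (Fin.succ_le_castSucc_iff.1 hj) W hW Y hY n f) 1 f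
  have hiso (k : Fin (m + 1)) : k ≤ i.castSucc → Nonempty (X ≅ obj k) := by
    induction k using Fin.induction with
    | zero => exact fun _ => ⟨eqToIso h0.symm⟩
    | succ k ih =>
      intro hk
      obtain ⟨e⟩ := ih (Fin.castSucc_lt_succ.le.trans hk)
      obtain ⟨Z, hZ, g, h, hT⟩ := hmap k
      have hg : g = 0 := by
        rw [← cancel_epi e.hom, comp_zero]
        exact hom_eq_zero_of_shift_zero (hlt k (Fin.succ_le_castSucc_iff.1 hk) Z hZ 0) _
      obtain ⟨φ, hφ⟩ := Triangle.yoneda_exact₃ _ hT (𝟙 Z) ((Category.comp_id g).trans hg)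
      have hZ0 : IsZero Z := by
        rw [IsZero.iff_id_eq_zero, hφ, hvan k hZ φ]
        exact comp_zero
      have : IsIso (map k) := (Triangle.isZero₃_iff_isIso₁ _ hT).1 hZ0
      exact ⟨e ≪≫ (asIso (map k)).symm⟩
  obtain ⟨e⟩ := hiso i.castSucc le_rfl
  obtain ⟨Z, hZ, g, h, hT⟩ := hmap i
  have hm : map i = 0 := by
    rw [← cancel_mono e.inv, zero_comp]
    exact hom_eq_zero_of_shift_zero (filtration_hom_eq_zero hlast hmap i.succ
      (fun j hj => hgt j (Fin.succ_le_castSucc_iff.1 hj)) 0) _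
  obtain ⟨φ, hφ⟩ := Triangle.coyoneda_exact₁ _ hT (𝟙 ((obj i.succ)⟦(1 : ℤ)⟧)) (by
    refine (Category.id_comp _).trans ((congrArg (fun f => f⟦(1 : ℤ)⟧') hm).trans ?_)
    exact (shiftFunctor C (1 : ℤ)).map_zero _ _)
  have hshift : IsZero ((obj i.succ)⟦(1 : ℤ)⟧) := by
    rw [IsZero.iff_id_eq_zero]
    refine hφ.trans ?_
    rw [hvan i hZ φ]
    exact zero_comp
  have hz : IsZero (obj i.succ) := by
    rw [IsZero.iff_id_eq_zero]
    exact (shiftFunctor C (1 : ℤ)).map_injective (hshift.eq_of_src _ _)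
  have : IsIso g := (Triangle.isZero₁_iff_isIso₂ _ hT).1 hz
  exact (hA.sub i).iso_closed (e ≪≫ asIso g).symm hZ

end Orthogonality

variable {C : Type u} [Category.{v} C] [Preadditive C] [HasZeroObject C]
  [HasShift C ℤ] [∀ n : ℤ, (shiftFunctor C n).Additive] [Pretriangulated C]
  {D : Type u'} [Category.{v'} D] [Preadditive D] [HasZeroObject D]
  [HasShift D ℤ] [∀ n : ℤ, (shiftFunctor D n).Additive] [Pretriangulated D]

theorem sod_compatible_unique_eq_preimage
    (Φ : C ⥤ D) [Φ.CommShift ℤ] [Φ.IsTriangulated] [Φ.Full] [Φ.Faithful]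
    (m : ℕ) (A' : Fin m → Set D) (hA' : IsSOD m A')
    (A : Fin m → Set C) (hA : IsSOD m A)
    (hcompat : ∀ i : Fin m, ∀ X ∈ A i, Φ.obj X ∈ A' i) :
    ∀ i : Fin m, A i = {X : C | Φ.obj X ∈ A' i} := by
  intro i
  have hvan {X Y : C} {n : ℤ} (h : ∀ f : (Φ.obj Y)⟦n⟧ ⟶ Φ.obj X, f = 0) (f : Y⟦n⟧ ⟶ X) :
      f = 0 := by
    apply Φ.map_injective
    rw [← cancel_epi ((Φ.commShiftIso n).inv.app Y), Φ.map_zero, comp_zero]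
    exact h _
  refine Set.Subset.antisymm (hcompat i) fun X hX => hA.mem_of_orthogonal i ?_ ?_
  · exact fun j hj Y hY n => hvan (hA'.semiorth i j hj _ hX _ (hcompat j Y hY) n)
  · exact fun j hj Y hY n => hvan (hA'.semiorth j i hj _ (hcompat j Y hY) _ hX n)
end

section
/- Let Φ : T → T' be a fully faithful triangulated functor and let T' = ⟨A'_1, …, A'_m⟩ be a semiorthogonal decomposition. Then the full subcategories A_i = Φ^{-1}(A'_i) = {X ∈ T : Φ(X) ∈ A'_i} form a semiorthogonal decomposition of T if and only if the essential image of Φ is stable under the projection functors α'_i of the decomposition of T', i.e. for every object X of T and every i the object α'_i(Φ(X)) is isomorphic to Φ(Y) for some object Y of T. -/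
/-!
STATEMENT 6:
Let `Φ : T → T'` be a fully faithful triangulated functor and let `T' = ⟨A'_1, …, A'_m⟩` be a
semiorthogonal decomposition. Then the full subcategories `A_i = Φ⁻¹(A'_i)` form a
semiorthogonal decomposition of `T` if and only if the essential image of `Φ` is stable under
the projection functors `α'_i` of the decomposition of `T'`, i.e. for every object `X` of `T`
and every `i` the object `α'_i(Φ(X))` is isomorphic to `Φ(Y)` for some object `Y` of `T`.
-/

open CategoryTheory CategoryTheory.Limits CategoryTheory.Pretriangulated ZeroObject

universe v u v' u'

variable {C : Type u} [Category.{v} C] [Preadditive C] [HasZeroObject C]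
  [HasShift C ℤ] [∀ n : ℤ, (shiftFunctor C n).Additive] [Pretriangulated C]
  {D : Type u'} [Category.{v'} D] [Preadditive D] [HasZeroObject D]
  [HasShift D ℤ] [∀ n : ℤ, (shiftFunctor D n).Additive] [Pretriangulated D]

/-- A chain of distinguished triangles `obj (k + 1) ⟶ obj k ⟶ piece k ⟶ (obj (k + 1))⟦1⟧` ending
in zero, with `piece k` in `A k`. -/
structure SODChain {m : ℕ} (A : Fin m → Set C) where
  obj : Fin (m + 1) → C
  piece : Fin m → C
  isZero_last : IsZero (obj (Fin.last m))
  map : ∀ k : Fin m, obj k.succ ⟶ obj k.castSucc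
  g : ∀ k : Fin m, obj k.castSucc ⟶ piece k
  h : ∀ k : Fin m, piece k ⟶ (obj k.succ)⟦(1 : ℤ)⟧
  piece_mem : ∀ k : Fin m, piece k ∈ A k
  distinguished : ∀ k : Fin m, Triangle.mk (map k) (g k) (h k) ∈ distTriang C

/-- The chain of an object given by the projection functors. -/
def ProjectionData.chain {m : ℕ} {A : Fin m → Set C} (P : ProjectionData m A) (X : C) :
    SODChain A where
  obj k := (P.obj k).obj X
  piece k := (P.proj k).obj X
  isZero_last := P.isZero_last X
  map k := (P.map k).app X
  g k := (P.g k).app X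
  h k := (P.h k).app X
  piece_mem k := P.proj_mem k X
  distinguished k := P.distinguished k X

lemma IsSOD.hom_eq_zero {m : ℕ} {A : Fin m → Set C} (hA : IsSOD m A) {i j : Fin m} (hij : i < j)
    {X Y : C} (hX : X ∈ A i) (hY : Y ∈ A j) (f : Y ⟶ X) : f = 0 := by
  have hf := hA.semiorth i j hij X hX Y hY 0 ((shiftFunctorZero C ℤ).hom.app Y ≫ f)
  rwa [← cancel_epi ((shiftFunctorZero C ℤ).hom.app Y), comp_zero]

lemma SODChain.hom_eq_zero {m : ℕ} {A : Fin m → Set C} (hA : IsSOD m A) (S : SODChain A)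
    (k : Fin (m + 1)) {i : Fin m} (hik : i.castSucc < k) {X : C} (hX : X ∈ A i)
    (f : S.obj k ⟶ X) : f = 0 := by
  induction k using Fin.reverseInduction with
  | last => exact S.isZero_last.eq_of_src _ _
  | cast k ih =>
    have hik' : i < k := Fin.castSucc_lt_castSucc_iff.1 hik
    obtain ⟨φ, rfl⟩ := Triangle.yoneda_exact₂ _ (S.distinguished k) f
      (ih (hik.trans (Fin.castSucc_lt_succ)) _)
    exact (congrArg (S.g k ≫ ·) (hA.hom_eq_zero hik' hX (S.piece_mem k) φ)).trans comp_zero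

/-- Two factorizations through the first morphism of a distinguished triangle agree when the
shifted third object receives no nonzero morphism. -/
lemma eq_of_comp_mor₁_eq {T : Triangle C} (hT : T ∈ distTriang C) {B : C}
    (hB : ∀ f : B ⟶ T.obj₃⟦(-1 : ℤ)⟧, f = 0) {a b : B ⟶ T.obj₁}
    (hab : a ≫ T.mor₁ = b ≫ T.mor₁) : a = b := by
  obtain ⟨φ, hφ⟩ := Triangle.coyoneda_exact₂ _ (inv_rot_of_distTriang _ hT) (a - b)
    (by
      change (a - b) ≫ T.mor₁ = 0
      rw [Preadditive.sub_comp, hab, sub_self])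
  rw [← sub_eq_zero, hφ]
  exact (congrArg (· ≫ T.invRotate.mor₁) (hB φ)).trans zero_comp

lemma exists_hom₁_of_hom_eq_zero {T T' : Triangle C} (hT' : T' ∈ distTriang C)
    (h₀ : ∀ f : T.obj₁ ⟶ T'.obj₃, f = 0) (e : T.obj₂ ⟶ T'.obj₂) :
    ∃ a : T.obj₁ ⟶ T'.obj₁, T.mor₁ ≫ e = a ≫ T'.mor₁ :=
  Triangle.coyoneda_exact₂ _ hT' (T.mor₁ ≫ e) (h₀ _)

/-- A distinguished triangle is determined by its middle object when its outer objects lie in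
semiorthogonal classes. -/
lemma nonempty_iso_of_hom_eq_zero {T T' : Triangle C} (hT : T ∈ distTriang C)
    (hT' : T' ∈ distTriang C) (e : T.obj₂ ≅ T'.obj₂)
    (h : ∀ f : T.obj₁ ⟶ T'.obj₃, f = 0) (h' : ∀ f : T'.obj₁ ⟶ T.obj₃, f = 0)
    (hs : ∀ f : T.obj₁ ⟶ T.obj₃⟦(-1 : ℤ)⟧, f = 0)
    (hs' : ∀ f : T'.obj₁ ⟶ T'.obj₃⟦(-1 : ℤ)⟧, f = 0) :
    Nonempty (T ≅ T') := by
  obtain ⟨a, ha⟩ := exists_hom₁_of_hom_eq_zero hT' h e.hom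
  obtain ⟨b, hb⟩ := exists_hom₁_of_hom_eq_zero hT h' e.inv
  let e₁ : T.obj₁ ≅ T'.obj₁ :=
    { hom := a
      inv := b
      hom_inv_id := eq_of_comp_mor₁_eq hT hs (by
        rw [Category.assoc, ← hb, ← reassoc_of% ha, e.hom_inv_id, Category.comp_id,
          Category.id_comp])
      inv_hom_id := eq_of_comp_mor₁_eq hT' hs' (by
        rw [Category.assoc, ← ha, ← reassoc_of% hb, e.inv_hom_id, Category.comp_id,
          Category.id_comp]) }
  exact ⟨isoTriangleOfIso₁₂ T T' hT hT' e₁ e ha⟩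

lemma SODChain.nonempty_triangle_iso {m : ℕ} {A : Fin m → Set C} (hA : IsSOD m A)
    (S S' : SODChain A) (k : Fin m) (e : S.obj k.castSucc ≅ S'.obj k.castSucc) :
    Nonempty (Triangle.mk (S.map k) (S.g k) (S.h k) ≅
      Triangle.mk (S'.map k) (S'.g k) (S'.h k)) := by
  have hlt : k.castSucc < k.succ := Fin.castSucc_lt_succ
  exact nonempty_iso_of_hom_eq_zero (S.distinguished k) (S'.distinguished k) e
    (S.hom_eq_zero hA _ hlt (S'.piece_mem k)) (S'.hom_eq_zero hA _ hlt (S.piece_mem k))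
    (S.hom_eq_zero hA _ hlt ((hA.sub k).shift_mem _ (S.piece_mem k) _))
    (S'.hom_eq_zero hA _ hlt ((hA.sub k).shift_mem _ (S'.piece_mem k) _))

lemma SODChain.nonempty_obj_iso {m : ℕ} {A : Fin m → Set C} (hA : IsSOD m A)
    (S S' : SODChain A) (e : S.obj 0 ≅ S'.obj 0) (k : Fin (m + 1)) :
    Nonempty (S.obj k ≅ S'.obj k) := by
  induction k using Fin.induction with
  | zero => exact ⟨e⟩
  | succ k ih =>
    obtain ⟨e'⟩ := ih
    obtain ⟨t⟩ := S.nonempty_triangle_iso hA S' k e'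
    exact ⟨Triangle.π₁.mapIso t⟩

lemma SODChain.nonempty_piece_iso {m : ℕ} {A : Fin m → Set C} (hA : IsSOD m A)
    (S S' : SODChain A) (e : S.obj 0 ≅ S'.obj 0) (k : Fin m) :
    Nonempty (S.piece k ≅ S'.piece k) := by
  obtain ⟨e'⟩ := S.nonempty_obj_iso hA S' e k.castSucc
  obtain ⟨t⟩ := S.nonempty_triangle_iso hA S' k e'
  exact ⟨Triangle.π₃.mapIso t⟩

/-- The image of a chain for the preimage subcategories under a triangulated functor. -/
noncomputable def SODChain.image (Φ : C ⥤ D) [Φ.CommShift ℤ] [Φ.IsTriangulated] {m : ℕ}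
    {A' : Fin m → Set D} (S : SODChain (fun i => {X : C | Φ.obj X ∈ A' i})) : SODChain A' where
  obj k := Φ.obj (S.obj k)
  piece k := Φ.obj (S.piece k)
  isZero_last := Φ.map_isZero S.isZero_last
  map k := Φ.map (S.map k)
  g k := Φ.map (S.g k)
  h k := Φ.map (S.h k) ≫ (Φ.commShiftIso (1 : ℤ)).hom.app _
  piece_mem := S.piece_mem
  distinguished k := Φ.map_distinguished _ (S.distinguished k)

lemma IsSOD.exists_chain {m : ℕ} {A : Fin m → Set C} (hA : IsSOD m A) (X : C) :
    ∃ S : SODChain A, S.obj 0 = X := by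
  obtain ⟨obj, map, hlast, h0, hk⟩ := hA.filtration X
  choose Z hZ g h hT using hk
  exact ⟨⟨obj, Z, hlast, map, g, h, hZ, hT⟩, h0⟩

/-- A distinguished triangle on objects isomorphic to images under a fully faithful triangulated
functor comes from a distinguished triangle on the chosen preimages. -/
lemma exists_distinguished_of_iso (Φ : C ⥤ D) [Φ.CommShift ℤ] [Φ.IsTriangulated] [Φ.Full]
    [Φ.Faithful] {T : Triangle D} (hT : T ∈ distTriang D) {X₁ X₂ X₃ : C}
    (e₁ : Φ.obj X₁ ≅ T.obj₁) (e₂ : Φ.obj X₂ ≅ T.obj₂) (e₃ : Φ.obj X₃ ≅ T.obj₃) :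
    ∃ (f : X₁ ⟶ X₂) (g : X₂ ⟶ X₃) (h : X₃ ⟶ X₁⟦(1 : ℤ)⟧), Triangle.mk f g h ∈ distTriang C := by
  refine ⟨Φ.preimage (e₁.hom ≫ T.mor₁ ≫ e₂.inv), Φ.preimage (e₂.hom ≫ T.mor₂ ≫ e₃.inv),
    Φ.preimage (e₃.hom ≫ T.mor₃ ≫ e₁.inv⟦(1 : ℤ)⟧' ≫ (Φ.commShiftIso (1 : ℤ)).inv.app X₁), ?_⟩
  rw [← Φ.map_distinguished_iff]
  refine isomorphic_distinguished _ hT _ (Triangle.isoMk _ _ e₁ e₂ e₃ ?_ ?_ ?_)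
  · change Φ.map (Φ.preimage _) ≫ e₂.hom = e₁.hom ≫ T.mor₁
    simp
  · change Φ.map (Φ.preimage _) ≫ e₃.hom = e₂.hom ≫ T.mor₂
    simp
  · change (Φ.map (Φ.preimage _) ≫ (Φ.commShiftIso (1 : ℤ)).hom.app X₁) ≫ e₁.hom⟦(1 : ℤ)⟧' =
      e₃.hom ≫ T.mor₃
    simp [← Functor.map_comp]

lemma IsTriangulatedSub.preimage (Φ : C ⥤ D) [Φ.CommShift ℤ] [Φ.IsTriangulated] {S : Set D}
    (hS : IsTriangulatedSub S) : IsTriangulatedSub {X : C | Φ.obj X ∈ S} where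
  zero_mem := hS.iso_closed (Φ.map_isZero (isZero_zero C)).isoZero.symm hS.zero_mem
  iso_closed e hX := hS.iso_closed (Φ.mapIso e) hX
  shift_mem X hX n := hS.iso_closed ((Φ.commShiftIso n).app X).symm (hS.shift_mem _ hX n)
  ext₂ T hT h₁ h₃ := hS.ext₂ _ (Φ.map_distinguished T hT) h₁ h₃

theorem preimage_sod_iff_essImage_stable
    (Φ : C ⥤ D) [Φ.CommShift ℤ] [Φ.IsTriangulated] [Φ.Full] [Φ.Faithful]
    (m : ℕ) (A' : Fin m → Set D) (hA' : IsSOD m A') (P' : ProjectionData m A') :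
    IsSOD m (fun i => {X : C | Φ.obj X ∈ A' i}) ↔
      ∀ (i : Fin m) (X : C), ∃ Y : C, Nonempty ((P'.proj i).obj (Φ.obj X) ≅ Φ.obj Y) := by
  constructor
  · intro hA i X
    obtain ⟨S, rfl⟩ := hA.exists_chain X
    obtain ⟨e⟩ := (P'.chain (Φ.obj (S.obj 0))).nonempty_piece_iso hA' (S.image Φ)
      (P'.objZeroIso.app _) i
    exact ⟨S.piece i, ⟨e⟩⟩
  · intro hst
    refine ⟨fun i => (hA'.sub i).preimage Φ, fun i j hij X hX Y hY k f => ?_, fun X => ?_⟩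
    · exact Φ.map_injective ((hA'.hom_eq_zero hij hX
        (((hA'.sub j).preimage Φ).shift_mem Y hY k) (Φ.map f)).trans (Φ.map_zero _ _).symm)
    · have hobj (k : Fin (m + 1)) : Φ.essImage ((P'.obj k).obj (Φ.obj X)) := by
        induction k using Fin.induction with
        | zero => exact ⟨X, ⟨(P'.objZeroIso.app (Φ.obj X)).symm⟩⟩
        | succ k ih =>
          obtain ⟨Y, ⟨e⟩⟩ := hst k X
          exact Φ.essImage.ext_of_isTriangulatedClosed₁ _ (P'.distinguished k (Φ.obj X)) ih
            ⟨Y, ⟨e.symm⟩⟩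
      obtain ⟨O, hO₀, hO⟩ : ∃ O : Fin (m + 1) → C, O 0 = X ∧
          ∀ k, Nonempty (Φ.obj (O k) ≅ (P'.obj k).obj (Φ.obj X)) := by
        choose W hW using hobj
        refine ⟨Fin.cases X fun k => W k.succ, rfl, Fin.cases ?_ fun k => hW k.succ⟩
        exact ⟨(P'.objZeroIso.app (Φ.obj X)).symm⟩
      have htri (k : Fin m) : ∃ Z, Φ.obj Z ∈ A' k ∧ ∃ (f : O k.succ ⟶ O k.castSucc)
          (g : O k.castSucc ⟶ Z) (h : Z ⟶ (O k.succ)⟦(1 : ℤ)⟧),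
          Triangle.mk f g h ∈ distTriang C := by
        obtain ⟨Y, ⟨e⟩⟩ := hst k X
        obtain ⟨e₁⟩ := hO k.succ
        obtain ⟨e₂⟩ := hO k.castSucc
        exact ⟨Y, (hA'.sub k).iso_closed e (P'.proj_mem k _),
          exists_distinguished_of_iso Φ (P'.distinguished k (Φ.obj X)) e₁ e₂ e.symm⟩
      choose Z hZ f g h hT using htri
      obtain ⟨e⟩ := hO (Fin.last m)
      have hlast := (P'.isZero_last (Φ.obj X)).of_iso e
      refine ⟨O, f, ?_, hO₀, fun k => ⟨Z k, hZ k, g k, h k, hT k⟩⟩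
      rw [IsZero.iff_id_eq_zero]
      exact Φ.map_injective (hlast.eq_of_src _ _)
end

section
/- Let T be a triangulated category admitting arbitrary (small) coproducts, let C ⊂ T be the full subcategory of compact objects, and assume that the smallest strictly full triangulated subcategory of T containing C and closed under arbitrary coproducts is T itself. Given a semiorthogonal decomposition C = ⟨A_1, …, A_m⟩ of the triangulated category C, let Â_i be the smallest strictly full triangulated subcategory of T containing A_i and closed under arbitrary coproducts. Then T = ⟨Â_1, …, Â_m⟩ is a semiorthogonal decomposition of T whose components are closed under arbitrary coproducts, it satisfies A_i ⊂ Â_i for each i, and it is the unique semiorthogonal decomposition of T with components closed under arbitrary coproducts and compatible with the inclusion C → T (i.e. with A_i ⊂ Â_i for all i). -/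
/-!
STATEMENT 16:
Let `T` be a triangulated category admitting arbitrary (small) coproducts, let `C ⊆ T` be the
full subcategory of compact objects, and assume that the smallest strictly full triangulated
subcategory of `T` containing `C` and closed under arbitrary coproducts is `T` itself. Given a
semiorthogonal decomposition `C = ⟨A_1, …, A_m⟩` of the triangulated category `C`, let `Â_i`
be the smallest strictly full triangulated subcategory of `T` containing `A_i` and closed
under arbitrary coproducts. Then `T = ⟨Â_1, …, Â_m⟩` is a semiorthogonal decomposition of `T`
whose components are closed under arbitrary coproducts, it satisfies `A_i ⊆ Â_i` for each
`i`, and it is the unique semiorthogonal decomposition of `T` with components closed under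
arbitrary coproducts and compatible with the inclusion `C → T` (i.e. with `A_i ⊆ Â_i` for
all `i`).
-/

open CategoryTheory CategoryTheory.Limits CategoryTheory.Pretriangulated ZeroObject

universe v u

variable {C : Type u} [Category.{v} C] [Preadditive C] [HasZeroObject C]
  [HasShift C ℤ] [∀ n : ℤ, (shiftFunctor C n).Additive] [Pretriangulated C]
  [HasCoproducts.{v} C]

/-- An object `P` is compact if for every small family `(F_α)` the canonical morphism
`⊕_α Hom(P, F_α) → Hom(P, ⊕_α F_α)` is an isomorphism. -/
def IsCompactObj (P : C) : Prop :=
  ∀ (ι : Type v) [DecidableEq ι] (F : ι → C),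
    Function.Bijective
      (DirectSum.toAddMonoid (fun α : ι =>
        AddMonoidHom.mk' (fun g : P ⟶ F α => g ≫ Sigma.ι F α)
          (fun _ _ => Preadditive.add_comp _ _ _ _ _ _)) :
        DirectSum ι (fun α => P ⟶ F α) → (P ⟶ ∐ F))

/-- The class of compact objects of `C`. -/
def Compacts : Set C := {X | IsCompactObj X}

/-- `S` is closed under arbitrary (small) coproducts. -/
def CoprodClosed (S : Set C) : Prop :=
  ∀ (ι : Type v) (F : ι → C), (∀ α, F α ∈ S) → (∐ F) ∈ S

/-- A strictly full triangulated subcategory closed under arbitrary (small) coproducts. -/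
structure IsCoprodClosedTriangulatedSub (S : Set C) : Prop where
  zero_mem : (0 : C) ∈ S
  iso_closed : ∀ {X Y : C}, (X ≅ Y) → X ∈ S → Y ∈ S
  shift_mem : ∀ X ∈ S, ∀ n : ℤ, X⟦n⟧ ∈ S
  ext₂ : ∀ (T : Triangle C), (T ∈ distTriang C) → T.obj₁ ∈ S → T.obj₃ ∈ S → T.obj₂ ∈ S
  coprod_mem : CoprodClosed S

/-- The smallest strictly full triangulated subcategory containing `E` and closed under
arbitrary coproducts. -/
def coprodHull (E : Set C) : Set C :=
  {X | ∀ S : Set C, IsCoprodClosedTriangulatedSub S → E ⊆ S → X ∈ S}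

/-- A semiorthogonal decomposition of the full triangulated subcategory of `C` whose class of
objects is `S`: the components are strictly full triangulated subcategories contained in
`S`, mutually semiorthogonal, and every object of `S` admits a filtration (within `S`)
whose cones lie in the components. -/
structure IsSODOn (S : Set C) (m : ℕ) (A : Fin m → Set C) : Prop where
  le : ∀ i, A i ⊆ S
  sub : ∀ i, IsTriangulatedSub (A i)
  semiorth : ∀ i j : Fin m, i < j → ∀ X ∈ A i, ∀ Y ∈ A j, ∀ k : ℤ, ∀ f : Y⟦k⟧ ⟶ X, f = 0
  filtration : ∀ X ∈ S, ∃ (obj : Fin (m + 1) → C)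
      (map : ∀ k : Fin m, obj k.succ ⟶ obj k.castSucc),
      (∀ k, obj k ∈ S) ∧ IsZero (obj (Fin.last m)) ∧ obj 0 = X ∧
      ∀ k : Fin m, ∃ Z ∈ A k, ∃ (g : obj k.castSucc ⟶ Z) (h : Z ⟶ (obj k.succ)⟦(1 : ℤ)⟧),
        (Triangle.mk (map k) g h ∈ distTriang C)

section Exactness

variable {D : Type u} [Category.{v} D] [Preadditive D] [HasZeroObject D]
  [HasShift D ℤ] [∀ n : ℤ, (shiftFunctor D n).Additive] [Pretriangulated D]
  {X Y Z W : D} {f : X ⟶ Y} {g : Y ⟶ Z} {h : Z ⟶ X⟦(1 : ℤ)⟧}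

lemma lift_to_obj₁ (hT : Triangle.mk f g h ∈ distTriang D) (k : W ⟶ Y) (hk : k ≫ g = 0) :
    ∃ l : W ⟶ X, k = l ≫ f :=
  Triangle.coyoneda_exact₂ _ hT k hk

lemma lift_to_obj₂ (hT : Triangle.mk f g h ∈ distTriang D) (k : W ⟶ Z) (hk : k ≫ h = 0) :
    ∃ l : W ⟶ Y, k = l ≫ g :=
  Triangle.coyoneda_exact₃ _ hT k hk

lemma lift_to_obj₃ (hT : Triangle.mk f g h ∈ distTriang D) (k : W ⟶ X⟦(1 : ℤ)⟧)
    (hk : k ≫ f⟦(1 : ℤ)⟧' = 0) : ∃ l : W ⟶ Z, k = l ≫ h :=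
  Triangle.coyoneda_exact₁ _ hT k hk

lemma lift_to_shift_obj₁ (hT : Triangle.mk f g h ∈ distTriang D) (k : W ⟶ Y⟦(1 : ℤ)⟧)
    (hk : k ≫ g⟦(1 : ℤ)⟧' = 0) : ∃ l : W ⟶ X⟦(1 : ℤ)⟧, k = l ≫ f⟦(1 : ℤ)⟧' := by
  obtain ⟨l, hl⟩ := Triangle.coyoneda_exact₁ _ (rot_of_distTriang _ hT) k hk
  exact ⟨-l, hl.trans ((Preadditive.comp_neg _ _).trans (Preadditive.neg_comp _ _).symm)⟩

lemma desc_from_obj₃ (hT : Triangle.mk f g h ∈ distTriang D) (k : Y ⟶ W) (hk : f ≫ k = 0) :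
    ∃ l : Z ⟶ W, k = g ≫ l :=
  Triangle.yoneda_exact₂ _ hT k hk

lemma desc_from_shift_obj₁ (hT : Triangle.mk f g h ∈ distTriang D) (k : Z ⟶ W)
    (hk : g ≫ k = 0) : ∃ l : X⟦(1 : ℤ)⟧ ⟶ W, k = h ≫ l :=
  Triangle.yoneda_exact₃ _ hT k hk

lemma desc_from_shift_obj₂ (hT : Triangle.mk f g h ∈ distTriang D) (k : X⟦(1 : ℤ)⟧ ⟶ W)
    (hk : h ≫ k = 0) : ∃ l : Y⟦(1 : ℤ)⟧ ⟶ W, k = f⟦(1 : ℤ)⟧' ≫ l := by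
  obtain ⟨l, hl⟩ := Triangle.yoneda_exact₃ _ (rot_of_distTriang _ hT) k hk
  exact ⟨-l, hl.trans ((Preadditive.neg_comp _ _).trans (Preadditive.comp_neg _ _).symm)⟩

lemma desc_from_shift_obj₃ (hT : Triangle.mk f g h ∈ distTriang D) (k : Y⟦(1 : ℤ)⟧ ⟶ W)
    (hk : f⟦(1 : ℤ)⟧' ≫ k = 0) : ∃ l : Z⟦(1 : ℤ)⟧ ⟶ W, k = g⟦(1 : ℤ)⟧' ≫ l := by
  obtain ⟨l, hl⟩ := Triangle.yoneda_exact₃ _ (rot_of_distTriang _ (rot_of_distTriang _ hT)) k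
    (show (-f⟦(1 : ℤ)⟧') ≫ k = 0 by rw [Preadditive.neg_comp, hk, neg_zero])
  exact ⟨-l, hl.trans ((Preadditive.neg_comp _ _).trans (Preadditive.comp_neg _ _).symm)⟩

lemma comp_zero₁₂ (hT : Triangle.mk f g h ∈ distTriang D) : f ≫ g = 0 :=
  comp_distTriang_mor_zero₁₂ _ hT

lemma comp_zero₂₃ (hT : Triangle.mk f g h ∈ distTriang D) : g ≫ h = 0 :=
  comp_distTriang_mor_zero₂₃ _ hT

lemma comp_zero₃₁ (hT : Triangle.mk f g h ∈ distTriang D) : h ≫ f⟦(1 : ℤ)⟧' = 0 :=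
  comp_distTriang_mor_zero₃₁ _ hT

end Exactness

section ShiftCoproduct

variable {D : Type u} [Category.{v} D] [HasShift D ℤ] [HasCoproducts.{v} D]

lemma shift_sigma_hom_ext {ι : Type v} {F : ι → D} {W : D} (n : ℤ) {k l : (∐ F)⟦n⟧ ⟶ W}
    (h : ∀ j, (Sigma.ι F j)⟦n⟧' ≫ k = (Sigma.ι F j)⟦n⟧' ≫ l) : k = l :=
  Cofan.IsColimit.hom_ext
    (isColimitCofanMkObjOfIsColimit (shiftFunctor D n) F _ (coproductIsCoproduct F)) _ _ h

lemma exists_shift_sigma_desc {ι : Type v} {F : ι → D} {W : D} (n : ℤ)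
    (k : ∀ j, (F j)⟦n⟧ ⟶ W) : ∃ l : (∐ F)⟦n⟧ ⟶ W, ∀ j, (Sigma.ι F j)⟦n⟧' ≫ l = k j :=
  ⟨Cofan.IsColimit.desc
    (isColimitCofanMkObjOfIsColimit (shiftFunctor D n) F _ (coproductIsCoproduct F)) k,
    fun j => Cofan.IsColimit.fac
      (isColimitCofanMkObjOfIsColimit (shiftFunctor D n) F _ (coproductIsCoproduct F)) k j⟩

end ShiftCoproduct

lemma exists_sigma_triangle {ι : Type v} {X Y Z : ι → C} (f : ∀ j, X j ⟶ Y j)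
    (g : ∀ j, Y j ⟶ Z j) (h : ∀ j, Z j ⟶ (X j)⟦(1 : ℤ)⟧)
    (hT : ∀ j, Triangle.mk (f j) (g j) (h j) ∈ distTriang C) :
    ∃ (W : C) (_ : ∐ Z ≅ W) (a : ∐ X ⟶ ∐ Y) (b : ∐ Y ⟶ W) (c : W ⟶ (∐ X)⟦(1 : ℤ)⟧),
      Triangle.mk a b c ∈ distTriang C := by
  obtain ⟨W, b, c, hT'⟩ := distinguished_cocone_triangle (Limits.Sigma.map f)
  have hφ : ∀ j, ∃ t : Z j ⟶ W, g j ≫ t = Sigma.ι Y j ≫ b ∧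
      h j ≫ (Sigma.ι X j)⟦(1 : ℤ)⟧' = t ≫ c := fun j =>
    complete_distinguished_triangle_morphism _ _ (hT j) hT' (Sigma.ι X j) (Sigma.ι Y j)
      (Sigma.ι_map f j).symm
  choose t ht₂ ht₃ using hφ
  let d : ∐ Z ⟶ W := Sigma.desc t
  have hd : ∀ j, Sigma.ι Z j ≫ d = t j := fun j => by simp [d]
  have : Epi d := by
    refine Preadditive.epi_of_cancel_zero _ fun {V} k hk => ?_
    have htk : ∀ j, t j ≫ k = 0 := fun j => by rw [← hd, Category.assoc, hk, comp_zero]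
    have hbk : b ≫ k = 0 := by
      refine Sigma.hom_ext _ _ fun j => ?_
      rw [← Category.assoc, ← ht₂, Category.assoc, htk, comp_zero, comp_zero]
    obtain ⟨l, rfl⟩ := desc_from_shift_obj₁ hT' k hbk
    have hl : ∀ j, h j ≫ (Sigma.ι X j)⟦(1 : ℤ)⟧' ≫ l = 0 := fun j => by
      rw [← Category.assoc, ht₃, Category.assoc, htk]
    choose p hp using fun j => desc_from_shift_obj₂ (hT j) _ (hl j)
    obtain ⟨q, hq⟩ := exists_shift_sigma_desc (1 : ℤ) p
    have hlq : l = (Limits.Sigma.map f)⟦(1 : ℤ)⟧' ≫ q := by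
      refine shift_sigma_hom_ext 1 fun j => ?_
      rw [hp, ← hq, ← Category.assoc, ← Category.assoc, ← Functor.map_comp, ← Functor.map_comp,
        Sigma.ι_map]
    rw [hlq, ← Category.assoc, comp_zero₃₁ hT', zero_comp]
  obtain ⟨r, hr⟩ : ∃ r : W ⟶ ∐ Z, d ≫ r = 𝟙 _ := by
    obtain ⟨r, hr⟩ := desc_from_obj₃ hT' (Limits.Sigma.map g) (by
      refine Sigma.hom_ext _ _ fun j => ?_
      rw [Sigma.ι_map_assoc, Sigma.ι_map, ← Category.assoc, comp_zero₁₂ (hT j), zero_comp,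
        comp_zero])
    have hz : ∀ j, g j ≫ (t j ≫ r - Sigma.ι Z j) = 0 := fun j => by
      rw [Preadditive.comp_sub, ← Category.assoc, ht₂, Category.assoc, ← hr, Sigma.ι_map, sub_self]
    choose l hl using fun j => desc_from_shift_obj₁ (hT j) _ (hz j)
    obtain ⟨q, hq⟩ := exists_shift_sigma_desc (1 : ℤ) l
    refine ⟨r - c ≫ q, Sigma.hom_ext _ _ fun j => ?_⟩
    rw [← Category.assoc, hd, Preadditive.comp_sub, ← Category.assoc, ← ht₃, Category.assoc, hq,
      ← hl, sub_sub_cancel, Category.comp_id]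
  have : IsSplitMono d := ⟨⟨r, hr⟩⟩
  have : IsIso d := isIso_of_epi_of_isSplitMono d
  exact ⟨W, asIso d, Limits.Sigma.map f, b, c, hT'⟩

section Orthogonals

variable {D : Type u} [Category.{v} D] [Preadditive D]

/-- The class of objects without nonzero morphisms to the objects of `P`. -/
def leftPerp (P : Set D) : Set D := {Y | ∀ X ∈ P, ∀ f : Y ⟶ X, f = 0}

/-- The class of objects without nonzero morphisms from the objects of `Q`. -/
def rightPerp (Q : Set D) : Set D := {X | ∀ Y ∈ Q, ∀ f : Y ⟶ X, f = 0}

variable [HasShift D ℤ]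

/-- `S` is stable under all shifts. -/
def ShiftClosed (S : Set D) : Prop := ∀ X ∈ S, ∀ n : ℤ, X⟦n⟧ ∈ S

lemma ShiftClosed.leftPerp {P : Set D} (hP : ShiftClosed P) : ShiftClosed (leftPerp P) :=
  fun Y hY n X hX _ => ((shiftEquiv D n).toAdjunction.homEquiv Y X).injective
    ((hY _ (hP X hX (-n)) _).trans (hY _ (hP X hX (-n)) _).symm)

lemma ShiftClosed.rightPerp {Q : Set D} (hQ : ShiftClosed Q) : ShiftClosed (rightPerp Q) :=
  fun X hX n Y hY _ => ((shiftEquiv D n).symm.toAdjunction.homEquiv Y X).symm.injective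
    ((hX _ (hQ Y hY (-n)) _).trans (hX _ (hQ Y hY (-n)) _).symm)

end Orthogonals

lemma isCoprodClosedTriangulatedSub_leftPerp {P : Set C} (hP : ShiftClosed P) :
    IsCoprodClosedTriangulatedSub (leftPerp P) where
  zero_mem X _ f := (isZero_zero C).eq_of_src f 0
  iso_closed e hY X hX f := by
    rw [← cancel_epi e.hom, hY X hX (e.hom ≫ f), comp_zero]
  shift_mem := hP.leftPerp
  ext₂ T hT h₁ h₃ X hX f := by
    obtain ⟨g, rfl⟩ := T.yoneda_exact₂ hT f (h₁ X hX _)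
    rw [h₃ X hX g, comp_zero]
  coprod_mem ι F hF X hX f :=
    Sigma.hom_ext _ _ fun j => by rw [hF j X hX (Sigma.ι F j ≫ f), comp_zero]

lemma isCoprodClosedTriangulatedSub_rightPerp {Q : Set C} (hQ : ShiftClosed Q)
    (hQc : Q ⊆ Compacts) : IsCoprodClosedTriangulatedSub (rightPerp Q) where
  zero_mem Y _ f := (isZero_zero C).eq_of_tgt f 0
  iso_closed e hX Y hY f := by
    rw [← cancel_mono e.inv, hX Y hY (f ≫ e.inv), zero_comp]
  shift_mem := hQ.rightPerp
  ext₂ T hT h₁ h₃ Y hY f := by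
    obtain ⟨g, rfl⟩ := T.coyoneda_exact₂ hT f (h₃ Y hY _)
    rw [h₁ Y hY g, zero_comp]
  coprod_mem ι F hF Y hY f := by
    classical
    obtain ⟨x, rfl⟩ := (hQc hY ι F).surjective f
    have hx : x = 0 := DFinsupp.ext fun j => hF j Y hY _
    rw [hx, map_zero]

lemma subset_coprodHull (E : Set C) : E ⊆ coprodHull E := fun _ hX _ _ hE => hE hX

lemma coprodHull_minimal {E S : Set C} (hS : IsCoprodClosedTriangulatedSub S) (hE : E ⊆ S) :
    coprodHull E ⊆ S := fun _ hX => hX S hS hE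

lemma isCoprodClosedTriangulatedSub_coprodHull (E : Set C) :
    IsCoprodClosedTriangulatedSub (coprodHull E) where
  zero_mem _ hS _ := hS.zero_mem
  iso_closed e hX S hS hE := hS.iso_closed e (hX S hS hE)
  shift_mem X hX n S hS hE := hS.shift_mem X (hX S hS hE) n
  ext₂ T hT h₁ h₃ S hS hE := hS.ext₂ T hT (h₁ S hS hE) (h₃ S hS hE)
  coprod_mem ι F hF S hS hE := hS.coprod_mem ι F fun j => hF j S hS hE

/-- Orthogonality of a class of compact objects to another class passes to the hulls. -/
lemma coprodHull_subset_leftPerp {P Q : Set C} (hQ : ShiftClosed Q)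
    (hQc : Q ⊆ Compacts) (hQP : Q ⊆ leftPerp P) : coprodHull Q ⊆ leftPerp (coprodHull P) := by
  have hP' : coprodHull P ⊆ rightPerp Q :=
    coprodHull_minimal (isCoprodClosedTriangulatedSub_rightPerp hQ hQc)
      fun X hX Y hY f => hQP hY X hX f
  exact coprodHull_minimal
    (isCoprodClosedTriangulatedSub_leftPerp (isCoprodClosedTriangulatedSub_coprodHull P).shift_mem)
    fun Y hY X hX f => hP' hX Y hY f

section Extensions

variable {D : Type u} [Category.{v} D] [Preadditive D] [HasZeroObject D]
  [HasShift D ℤ] [∀ n : ℤ, (shiftFunctor D n).Additive] [Pretriangulated D]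

/-- The class of objects `X` fitting in a distinguished triangle `Y ⟶ X ⟶ Z ⟶ Y⟦1⟧` with
`Y ∈ R` and `Z ∈ L`. -/
def extensions (R L : Set D) : Set D :=
  {X | ∃ Y ∈ R, ∃ Z ∈ L, ∃ (u : Y ⟶ X) (v : X ⟶ Z) (w : Z ⟶ Y⟦(1 : ℤ)⟧),
    Triangle.mk u v w ∈ distTriang D}

variable {R L : Set D}

lemma eq_zero_of_comp_shift {X Y Z A : D} {u : Y ⟶ X} {v : X ⟶ Z} {w : Z ⟶ Y⟦(1 : ℤ)⟧}
    (hT : Triangle.mk u v w ∈ distTriang D) (hZ : Z ∈ rightPerp R) (hA : A ∈ R)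
    (k : A ⟶ Y⟦(1 : ℤ)⟧) (hk : k ≫ u⟦(1 : ℤ)⟧' = 0) : k = 0 := by
  obtain ⟨l, rfl⟩ := lift_to_obj₃ hT k hk
  rw [hZ A hA l, zero_comp]

lemma eq_zero_of_comp (hR : ShiftClosed R) {X Y Z A : D} {u : Y ⟶ X} {v : X ⟶ Z}
    {w : Z ⟶ Y⟦(1 : ℤ)⟧} (hT : Triangle.mk u v w ∈ distTriang D) (hY : Y ∈ R)
    (hA : A ∈ rightPerp R) (k : Z ⟶ A) (hk : v ≫ k = 0) : k = 0 := by
  obtain ⟨l, rfl⟩ := desc_from_shift_obj₁ hT k hk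
  rw [hA _ (hR Y hY 1) l, comp_zero]

/-- Given a morphism from a distinguished triangle `A' ⟶ B' ⟶ C' ⟶ A'⟦1⟧` to a distinguished
triangle `A ⟶ B ⟶ C ⟶ A⟦1⟧`, if the cones of `A' ⟶ A` and `C' ⟶ C` are right orthogonal to
`R`, then so is the cone of `B' ⟶ B`. -/
lemma cone_mem_rightPerp {A B C A' B' C' A'' B'' C'' : D}
    {f : A ⟶ B} {g : B ⟶ C} {h : C ⟶ A⟦(1 : ℤ)⟧} (hT : Triangle.mk f g h ∈ distTriang D)
    {f' : A' ⟶ B'} {g' : B' ⟶ C'} {h' : C' ⟶ A'⟦(1 : ℤ)⟧}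
    (hT' : Triangle.mk f' g' h' ∈ distTriang D)
    {a : A' ⟶ A} {a' : A ⟶ A''} {a'' : A'' ⟶ A'⟦(1 : ℤ)⟧}
    (ha : Triangle.mk a a' a'' ∈ distTriang D) (hA : A'' ∈ rightPerp R)
    {c : C' ⟶ C} {c' : C ⟶ C''} {c'' : C'' ⟶ C'⟦(1 : ℤ)⟧}
    (hc : Triangle.mk c c' c'' ∈ distTriang D) (hC : C'' ∈ rightPerp R)
    {b : B' ⟶ B} {b' : B ⟶ B''} {b'' : B'' ⟶ B'⟦(1 : ℤ)⟧}
    (hb : Triangle.mk b b' b'' ∈ distTriang D)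
    (comm₁ : f' ≫ b = a ≫ f) (comm₂ : g' ≫ c = b ≫ g) (comm₃ : h' ≫ a⟦(1 : ℤ)⟧' = c ≫ h) :
    B'' ∈ rightPerp R := by
  intro X hX φ
  have key : φ ≫ b'' = 0 := by
    have hk : (φ ≫ b'') ≫ b⟦(1 : ℤ)⟧' = 0 := by
      rw [Category.assoc, comp_zero₃₁ hb, comp_zero]
    generalize φ ≫ b'' = k at hk ⊢
    have h₁ : k ≫ g'⟦(1 : ℤ)⟧' = 0 := by
      refine eq_zero_of_comp_shift hc hC hX _ ?_
      rw [Category.assoc, ← Functor.map_comp, comm₂, Functor.map_comp, ← Category.assoc, hk,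
        zero_comp]
    obtain ⟨l, rfl⟩ := lift_to_shift_obj₁ hT' k h₁
    obtain ⟨m, hm⟩ := lift_to_obj₃ hT (l ≫ a⟦(1 : ℤ)⟧') (by
      rw [Category.assoc, ← Functor.map_comp, ← comm₁, Functor.map_comp, ← Category.assoc, hk])
    obtain ⟨n, rfl⟩ := lift_to_obj₁ hc m (hC X hX _)
    have h₂ : l - n ≫ h' = 0 := by
      refine eq_zero_of_comp_shift ha hA hX _ ?_
      rw [Preadditive.sub_comp, Category.assoc, hm, comm₃, Category.assoc, sub_self]
    rw [sub_eq_zero.1 h₂, Category.assoc, comp_zero₃₁ hT', comp_zero]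
  obtain ⟨k, rfl⟩ := lift_to_obj₂ hb φ key
  obtain ⟨l, hl⟩ := lift_to_obj₁ hc (k ≫ g) (hC X hX _)
  have h₁ : l ≫ h' = 0 := by
    refine eq_zero_of_comp_shift ha hA hX _ ?_
    rw [Category.assoc, comm₃, ← Category.assoc, ← hl, Category.assoc, comp_zero₂₃ hT, comp_zero]
  obtain ⟨m, rfl⟩ := lift_to_obj₂ hT' l h₁
  obtain ⟨n, hn⟩ := lift_to_obj₁ hT (k - m ≫ b) (by
    rw [Preadditive.sub_comp, hl, Category.assoc, Category.assoc, comm₂, sub_self])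
  obtain ⟨p, rfl⟩ := lift_to_obj₁ ha n (hA X hX _)
  have hk : k = (m + p ≫ f') ≫ b := by
    rw [Preadditive.add_comp, Category.assoc, comm₁, ← Category.assoc, ← hn, add_sub_cancel]
  rw [hk, Category.assoc, comp_zero₁₂ hb, comp_zero]

section Precomposition

variable {A B C A' B' C' A'' C'' : D}
  {f : A ⟶ B} {g : B ⟶ C} {h : C ⟶ A⟦(1 : ℤ)⟧}
  {f' : A' ⟶ B'} {g' : B' ⟶ C'} {h' : C' ⟶ A'⟦(1 : ℤ)⟧}
  {a : A'' ⟶ A} {a' : A ⟶ A'} {a'' : A' ⟶ A''⟦(1 : ℤ)⟧}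
  {c : C'' ⟶ C} {c' : C ⟶ C'} {c'' : C' ⟶ C''⟦(1 : ℤ)⟧} {b : B ⟶ B'} {X : D}

/-- Given a morphism from a distinguished triangle `A ⟶ B ⟶ C ⟶ A⟦1⟧` to a distinguished
triangle `A' ⟶ B' ⟶ C' ⟶ A'⟦1⟧`, if the fibers of `A ⟶ A'` and `C ⟶ C'` are in `R`, then
morphisms from `B` to objects right orthogonal to `R` factor through `B ⟶ B'`. -/
lemma exists_factorization (hR : ShiftClosed R)
    (hT : Triangle.mk f g h ∈ distTriang D) (hT' : Triangle.mk f' g' h' ∈ distTriang D)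
    (ha : Triangle.mk a a' a'' ∈ distTriang D) (hA : A'' ∈ R)
    (hc : Triangle.mk c c' c'' ∈ distTriang D) (hC : C'' ∈ R)
    (comm₁ : f ≫ b = a' ≫ f') (comm₂ : g ≫ c' = b ≫ g') (comm₃ : h ≫ a'⟦(1 : ℤ)⟧' = c' ≫ h')
    (hX : X ∈ rightPerp R) (k : B ⟶ X) : ∃ l : B' ⟶ X, k = b ≫ l := by
  obtain ⟨l, hl⟩ := desc_from_obj₃ ha (f ≫ k) (hX _ hA _)
  have h₁ : h' ≫ l⟦(1 : ℤ)⟧' = 0 := by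
    refine eq_zero_of_comp hR hc hC (hR.rightPerp X hX 1) _ ?_
    rw [← Category.assoc, ← comm₃, Category.assoc, ← Functor.map_comp, ← hl, Functor.map_comp,
      ← Category.assoc, comp_zero₃₁ hT, zero_comp]
  obtain ⟨m, hm⟩ := desc_from_shift_obj₂ hT' _ h₁
  obtain ⟨m, rfl⟩ := (shiftFunctor D (1 : ℤ)).map_surjective m
  rw [← Functor.map_comp] at hm
  obtain rfl := (shiftFunctor D (1 : ℤ)).map_injective hm
  obtain ⟨n, hn⟩ := desc_from_obj₃ hT (k - b ≫ m) (by
    rw [Preadditive.comp_sub, hl, ← Category.assoc, ← Category.assoc, comm₁, sub_self])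
  obtain ⟨p, rfl⟩ := desc_from_obj₃ hc n (hX _ hC _)
  refine ⟨m + g' ≫ p, ?_⟩
  rw [Preadditive.comp_add, ← Category.assoc b, ← comm₂, Category.assoc, ← hn, add_sub_cancel]

lemma eq_zero_of_precomp (hR : ShiftClosed R)
    (hT : Triangle.mk f g h ∈ distTriang D) (hT' : Triangle.mk f' g' h' ∈ distTriang D)
    (ha : Triangle.mk a a' a'' ∈ distTriang D) (hA : A'' ∈ R)
    (hc : Triangle.mk c c' c'' ∈ distTriang D) (hC : C'' ∈ R)
    (comm₁ : f ≫ b = a' ≫ f') (comm₂ : g ≫ c' = b ≫ g') (comm₃ : h ≫ a'⟦(1 : ℤ)⟧' = c' ≫ h')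
    (hX : X ∈ rightPerp R) (k : B' ⟶ X) (hk : b ≫ k = 0) : k = 0 := by
  have h₁ : f' ≫ k = 0 := by
    refine eq_zero_of_comp hR ha hA hX _ ?_
    rw [← Category.assoc, ← comm₁, Category.assoc, hk, comp_zero]
  obtain ⟨l, rfl⟩ := desc_from_obj₃ hT' k h₁
  obtain ⟨m, hm⟩ := desc_from_shift_obj₁ hT (c' ≫ l) (by
    rw [← Category.assoc, comm₂, Category.assoc, hk])
  obtain ⟨n, rfl⟩ := desc_from_shift_obj₃ ha m (hX _ (hR _ hA 1) _)
  have h₂ : l - h' ≫ n = 0 := by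
    refine eq_zero_of_comp hR hc hC hX _ ?_
    rw [Preadditive.comp_sub, hm, ← Category.assoc, ← Category.assoc, comm₃, sub_self]
  rw [sub_eq_zero.1 h₂, ← Category.assoc, comp_zero₂₃ hT', zero_comp]

end Precomposition

/-- Extensions of semiorthogonal triangulated subcategories are stable under extensions. -/
lemma extensions_ext (hR : ShiftClosed R)
    (hR₂ : ∀ T ∈ distTriang D, T.obj₁ ∈ R → T.obj₃ ∈ R → T.obj₂ ∈ R)
    (hL : ShiftClosed L) (hL' : ∀ {X Y : D}, (X ≅ Y) → X ∈ L → Y ∈ L)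
    (hL₂ : ∀ T ∈ distTriang D, T.obj₁ ∈ L → T.obj₃ ∈ L → T.obj₂ ∈ L)
    (hRL : R ⊆ leftPerp L) {A B C : D} {f : A ⟶ B} {g : B ⟶ C} {h : C ⟶ A⟦(1 : ℤ)⟧}
    (hT : Triangle.mk f g h ∈ distTriang D)
    (hA : A ∈ extensions R L) (hC : C ∈ extensions R L) : B ∈ extensions R L := by
  obtain ⟨A₁, hA₁, A₂, hA₂, a, a', a'', ha⟩ := hA
  obtain ⟨C₁, hC₁, C₂, hC₂, c, c', c'', hc⟩ := hC
  have hLR : L ⊆ rightPerp R := fun X hX Y hY k => hRL hY X hX k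
  obtain ⟨s, hs⟩ : ∃ s : C₁ ⟶ A₁⟦(1 : ℤ)⟧, c ≫ h = s ≫ a⟦(1 : ℤ)⟧' :=
    lift_to_shift_obj₁ ha _ (hRL hC₁ _ (hL _ hA₂ 1) _)
  obtain ⟨s', hs'⟩ : ∃ s' : C₂ ⟶ A₂⟦(1 : ℤ)⟧, h ≫ a'⟦(1 : ℤ)⟧' = c' ≫ s' :=
    desc_from_obj₃ hc _ (hRL hC₁ _ (hL _ hA₂ 1) _)
  obtain ⟨V, p, q, hV⟩ := distinguished_cocone_triangle₂ s
  obtain ⟨W, p', q', hW⟩ := distinguished_cocone_triangle₂ s'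
  have hVR : V ∈ R := hR₂ _ hV hA₁ hC₁
  have hWL : W ∈ L := hL₂ _ hW hA₂ hC₂
  obtain ⟨t, ht₁, ht₂⟩ : ∃ t : V ⟶ B, p ≫ t = a ≫ f ∧ q ≫ c = t ≫ g :=
    complete_distinguished_triangle_morphism₂ _ _ hV hT a c hs.symm
  obtain ⟨t', ht₁', ht₂'⟩ : ∃ t' : B ⟶ W, f ≫ t' = a' ≫ p' ∧ g ≫ c' = t' ≫ q' :=
    complete_distinguished_triangle_morphism₂ _ _ hT hW a' c' hs'
  obtain ⟨Z, x, y, hZ⟩ := distinguished_cocone_triangle t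
  have hZR : Z ∈ rightPerp R :=
    cone_mem_rightPerp hT hV ha (hLR hA₂) hc (hLR hC₂) hZ ht₁ ht₂ hs.symm
  obtain ⟨α, hα⟩ := desc_from_obj₃ hZ t' (hRL hVR _ hWL _)
  obtain ⟨β, hβ⟩ := exists_factorization hR hT hW ha hA₁ hc hC₁ ht₁' ht₂' hs' hZR x
  have hαβ : α ≫ β - 𝟙 _ = 0 := eq_zero_of_comp hR hZ hVR hZR _ (by
    rw [Preadditive.comp_sub, ← Category.assoc, ← hα, ← hβ, Category.comp_id, sub_self])
  have hβα : β ≫ α - 𝟙 _ = 0 :=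
    eq_zero_of_precomp hR hT hW ha hA₁ hc hC₁ ht₁' ht₂' hs' (hLR hWL) _ (by
      rw [Preadditive.comp_sub, ← Category.assoc, ← hβ, ← hα, Category.comp_id, sub_self])
  exact ⟨V, hVR, Z, hL' ⟨β, α, sub_eq_zero.1 hβα, sub_eq_zero.1 hαβ⟩ hWL, t, x, y, hZ⟩

end Extensions

lemma isCoprodClosedTriangulatedSub_extensions {R L : Set C}
    (hR : IsCoprodClosedTriangulatedSub R) (hL : IsCoprodClosedTriangulatedSub L)
    (hRL : R ⊆ leftPerp L) : IsCoprodClosedTriangulatedSub (extensions R L) where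
  zero_mem := ⟨0, hR.zero_mem, 0, hL.zero_mem, 𝟙 0, 0, 0, contractible_distinguished 0⟩
  iso_closed {X X'} e hX := by
    obtain ⟨Y, hY, Z, hZ, u, v, w, hT⟩ := hX
    exact ⟨Y, hY, Z, hZ, u ≫ e.hom, e.inv ≫ v, w, isomorphic_distinguished _ hT _
      (Triangle.isoMk _ _ (Iso.refl _) e.symm (Iso.refl _)
        (show (u ≫ e.hom) ≫ e.inv = 𝟙 Y ≫ u by simp)
        (show (e.inv ≫ v) ≫ 𝟙 Z = e.inv ≫ v by simp)
        (show w ≫ (𝟙 Y)⟦(1 : ℤ)⟧' = 𝟙 Z ≫ w by simp))⟩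
  shift_mem X hX n := by
    obtain ⟨Y, hY, Z, hZ, u, v, w, hT⟩ := hX
    exact ⟨Y⟦n⟧, hR.shift_mem Y hY n, Z⟦n⟧, hL.shift_mem Z hZ n, _, _, _,
      Triangle.shift_distinguished _ hT n⟩
  ext₂ _ hT hA hC :=
    extensions_ext hR.shift_mem hR.ext₂ hL.shift_mem hL.iso_closed hL.ext₂ hRL hT hA hC
  coprod_mem ι F hF := by
    choose Y hY Z hZ u v w hT using hF
    obtain ⟨W, e, a, b, c, hW⟩ := exists_sigma_triangle u v w hT
    exact ⟨∐ Y, hR.coprod_mem ι Y hY, W, hL.iso_closed e (hL.coprod_mem ι Z hZ), a, b, c, hW⟩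

/-- The hull of `P ∪ Q` consists of extensions of the hulls of `Q` and `P`, if `Q` is a class
of compact objects left orthogonal to `P`. -/
lemma coprodHull_union_subset {P Q : Set C} (hQ : ShiftClosed Q)
    (hQc : Q ⊆ Compacts) (hQP : Q ⊆ leftPerp P) :
    coprodHull (P ∪ Q) ⊆ extensions (coprodHull Q) (coprodHull P) := by
  have hQ' := isCoprodClosedTriangulatedSub_coprodHull Q
  have hP' := isCoprodClosedTriangulatedSub_coprodHull P
  refine coprodHull_minimal (isCoprodClosedTriangulatedSub_extensions hQ' hP'
    (coprodHull_subset_leftPerp hQ hQc hQP)) (Set.union_subset (fun X hX => ?_) fun X hX => ?_)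
  · exact ⟨0, hQ'.zero_mem, X, subset_coprodHull P hX, 0, 𝟙 X, 0, contractible_distinguished₁ X⟩
  · exact ⟨X, subset_coprodHull Q hX, 0, hP'.zero_mem, 𝟙 X, 0, 0, contractible_distinguished X⟩

section Splitting

variable {D : Type u} [Category.{v} D] [Preadditive D] [HasZeroObject D]
  [HasShift D ℤ] [∀ n : ℤ, (shiftFunctor D n).Additive] [Pretriangulated D]
  {R L : Set D} {X Y Z : D} {u : Y ⟶ X} {v : X ⟶ Z} {w : Z ⟶ Y⟦(1 : ℤ)⟧}

lemma nonempty_iso_obj₁ (hR : ShiftClosed R) (hRL : R ⊆ leftPerp L) (hY : Y ∈ R) (hZ : Z ∈ L)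
    (hT : Triangle.mk u v w ∈ distTriang D) (hX : X ∈ leftPerp L) : Nonempty (Y ≅ X) := by
  obtain ⟨s, hs⟩ := lift_to_obj₁ hT (𝟙 X) (hX Z hZ _)
  have h : u ≫ s - 𝟙 Y = 0 := by
    apply (shiftFunctor D (1 : ℤ)).map_injective
    rw [Functor.map_zero]
    refine eq_zero_of_comp_shift (R := R) hT (fun A hA k => hRL hA Z hZ k) (hR Y hY 1) _ ?_
    rw [← Functor.map_comp, Preadditive.sub_comp, Category.assoc, ← hs, Category.comp_id,
      Category.id_comp, sub_self, Functor.map_zero]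
  exact ⟨⟨u, s, sub_eq_zero.1 h, hs.symm⟩⟩

lemma nonempty_iso_obj₃ (hR : ShiftClosed R) (hRL : R ⊆ leftPerp L) (hY : Y ∈ R) (hZ : Z ∈ L)
    (hT : Triangle.mk u v w ∈ distTriang D) (hX : X ∈ rightPerp R) : Nonempty (Z ≅ X) := by
  obtain ⟨r, hr⟩ := desc_from_obj₃ hT (𝟙 X) (hX Y hY _)
  have h : r ≫ v - 𝟙 Z = 0 := by
    refine eq_zero_of_comp (R := R) hR hT hY (fun A hA k => hRL hA Z hZ k) _ ?_
    rw [Preadditive.comp_sub, ← Category.assoc, ← hr, Category.comp_id, Category.id_comp,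
      sub_self]
  exact ⟨⟨r, v, sub_eq_zero.1 h, hr.symm⟩⟩

end Splitting

/-- The objects of the components `A i` with `k ≤ i`. -/
def tailUnion {D : Type u} {m : ℕ} (A : Fin m → Set D) (k : ℕ) : Set D :=
  {X | ∃ i : Fin m, k ≤ i ∧ X ∈ A i}

lemma tailUnion_eq_union {D : Type u} {m : ℕ} (A : Fin m → Set D) (k : Fin m) :
    tailUnion A k = A k ∪ tailUnion A (k + 1) := by
  ext X
  constructor
  · rintro ⟨i, hki, hX⟩
    obtain h | h := hki.eq_or_lt
    · exact Or.inl (Fin.ext h ▸ hX)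
    · exact Or.inr ⟨i, h, hX⟩
  · rintro (hX | ⟨i, hki, hX⟩)
    · exact ⟨k, le_rfl, hX⟩
    · exact ⟨i, (Nat.le_succ _).trans hki, hX⟩

lemma subset_leftPerp_of_semiorth {D : Type u} [Category.{v} D] [Preadditive D] [HasShift D ℤ]
    {P Q : Set D} (h : ∀ X ∈ P, ∀ Y ∈ Q, ∀ k : ℤ, ∀ f : Y⟦k⟧ ⟶ X, f = 0) : Q ⊆ leftPerp P :=
  fun Y hY X hX f => by
    rw [← cancel_epi ((shiftFunctorZero D ℤ).hom.app Y), comp_zero]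
    exact h X hX Y hY 0 _

lemma IsCoprodClosedTriangulatedSub.isTriangulatedSub {S : Set C}
    (hS : IsCoprodClosedTriangulatedSub S) : IsTriangulatedSub S where
  zero_mem := hS.zero_mem
  iso_closed := hS.iso_closed
  shift_mem := hS.shift_mem
  ext₂ := hS.ext₂

lemma IsTriangulatedSub.isCoprodClosed {S : Set C} (hS : IsTriangulatedSub S)
    (hS' : CoprodClosed S) : IsCoprodClosedTriangulatedSub S where
  zero_mem := hS.zero_mem
  iso_closed := hS.iso_closed
  shift_mem := hS.shift_mem
  ext₂ := hS.ext₂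
  coprod_mem := hS'

namespace IsSODOn

variable {m : ℕ} {A : Fin m → Set C}

lemma shiftClosed_tailUnion (hA : IsSODOn (Compacts : Set C) m A) (k : ℕ) :
    ShiftClosed (tailUnion A k) :=
  fun X ⟨i, hi, hX⟩ n => ⟨i, hi, (hA.sub i).shift_mem X hX n⟩

lemma tailUnion_subset_compacts (hA : IsSODOn (Compacts : Set C) m A) (k : ℕ) :
    tailUnion A k ⊆ Compacts := fun _ ⟨i, _, hX⟩ => hA.le i hX

lemma tailUnion_subset_leftPerp (hA : IsSODOn (Compacts : Set C) m A) (k : Fin m) :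
    tailUnion A (k + 1) ⊆ leftPerp (A k) :=
  fun _ ⟨i, hi, hY⟩ => subset_leftPerp_of_semiorth (hA.semiorth k i hi) hY

lemma coprodHull_tailUnion_subset_leftPerp (hA : IsSODOn (Compacts : Set C) m A) (k : Fin m) :
    coprodHull (tailUnion A (k + 1)) ⊆ leftPerp (coprodHull (A k)) :=
  coprodHull_subset_leftPerp (hA.shiftClosed_tailUnion _) (hA.tailUnion_subset_compacts _)
    (hA.tailUnion_subset_leftPerp k)

lemma coprodHull_tailUnion_subset_extensions (hA : IsSODOn (Compacts : Set C) m A) (k : Fin m) :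
    coprodHull (tailUnion A k) ⊆
      extensions (coprodHull (tailUnion A (k + 1))) (coprodHull (A k)) := by
  rw [tailUnion_eq_union]
  exact coprodHull_union_subset (hA.shiftClosed_tailUnion _) (hA.tailUnion_subset_compacts _)
    (hA.tailUnion_subset_leftPerp k)

lemma mem_coprodHull_tailUnion_zero (hgen : coprodHull (Compacts : Set C) = Set.univ)
    (hA : IsSODOn (Compacts : Set C) m A) (X : C) : X ∈ coprodHull (tailUnion A 0) := by
  have hS := isCoprodClosedTriangulatedSub_coprodHull (tailUnion A 0)
  refine coprodHull_minimal (E := Compacts) hS (fun Y hY => ?_) (hgen ▸ Set.mem_univ X)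
  obtain ⟨obj, map, -, hzero, rfl, hobj⟩ := hA.filtration Y hY
  refine Fin.reverseInduction (motive := fun k => obj k ∈ coprodHull (tailUnion A 0))
    (hS.iso_closed hzero.isoZero.symm hS.zero_mem) (fun k hk => ?_) 0
  obtain ⟨Z, hZ, g, h, hT⟩ := hobj k
  exact hS.ext₂ _ hT hk (subset_coprodHull _ ⟨k, Nat.zero_le _, hZ⟩)

lemma isZero_of_mem_coprodHull_tailUnion {X : C} (hX : X ∈ coprodHull (tailUnion A m)) :
    IsZero X := by
  have hX' : X ∈ leftPerp Set.univ :=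
    coprodHull_minimal (E := tailUnion A m)
      (isCoprodClosedTriangulatedSub_leftPerp fun _ _ _ => Set.mem_univ _)
      (fun _ ⟨i, hi, _⟩ => absurd i.isLt hi.not_gt) hX
  exact (IsZero.iff_id_eq_zero X).2 (hX' X (Set.mem_univ X) (𝟙 X))

lemma exists_filtration (hgen : coprodHull (Compacts : Set C) = Set.univ)
    (hA : IsSODOn (Compacts : Set C) m A) (X : C) : ∃ (obj : Fin (m + 1) → C)
      (map : ∀ k : Fin m, obj k.succ ⟶ obj k.castSucc),
      IsZero (obj (Fin.last m)) ∧ obj 0 = X ∧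
      ∀ k : Fin m, ∃ Z ∈ coprodHull (A k), ∃ (g : obj k.castSucc ⟶ Z)
        (h : Z ⟶ (obj k.succ)⟦(1 : ℤ)⟧), (Triangle.mk (map k) g h ∈ distTriang C) := by
  have step : ∀ (k : ℕ) (X : coprodHull (tailUnion A k)),
      ∃ (Y : coprodHull (tailUnion A (k + 1))) (u : Y.1 ⟶ X.1), ∀ hk : k < m,
        ∃ Z ∈ coprodHull (A ⟨k, hk⟩), ∃ (g : X.1 ⟶ Z) (h : Z ⟶ Y.1⟦(1 : ℤ)⟧),
          Triangle.mk u g h ∈ distTriang C := by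
    rintro k ⟨X, hX⟩
    by_cases hk : k < m
    · obtain ⟨Y, hY, Z, hZ, u, v, w, hT⟩ :=
        hA.coprodHull_tailUnion_subset_extensions ⟨k, hk⟩ hX
      exact ⟨⟨Y, hY⟩, u, fun _ => ⟨Z, hZ, v, w, hT⟩⟩
    · exact ⟨⟨0, (isCoprodClosedTriangulatedSub_coprodHull _).zero_mem⟩, 0,
        fun h => absurd h hk⟩
  choose Y u hY using step
  let obj : ∀ k : ℕ, coprodHull (tailUnion A k) := fun k =>
    Nat.rec ⟨X, mem_coprodHull_tailUnion_zero hgen hA X⟩ Y k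
  exact ⟨fun k => (obj k).1, fun k => u k (obj k),
    isZero_of_mem_coprodHull_tailUnion (obj m).2, rfl, fun k => hY k (obj k) k.isLt⟩

lemma isSOD_coprodHull (hgen : coprodHull (Compacts : Set C) = Set.univ)
    (hA : IsSODOn (Compacts : Set C) m A) : IsSOD m (fun i => coprodHull (A i)) where
  sub i := (isCoprodClosedTriangulatedSub_coprodHull (A i)).isTriangulatedSub
  semiorth i j hij X hX Y hY k f :=
    coprodHull_subset_leftPerp (hA.sub j).shift_mem (hA.le j)
      (subset_leftPerp_of_semiorth (hA.semiorth i j hij))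
      ((isCoprodClosedTriangulatedSub_coprodHull (A j)).shift_mem Y hY k) X hX f
  filtration := hA.exists_filtration hgen

lemma eq_coprodHull (hgen : coprodHull (Compacts : Set C) = Set.univ)
    (hA : IsSODOn (Compacts : Set C) m A) {B : Fin m → Set C} (hB : IsSOD m B)
    (hBc : ∀ i, CoprodClosed (B i)) (hAB : ∀ i, A i ⊆ B i) (i : Fin m) :
    B i = coprodHull (A i) := by
  have hsub : ∀ j, coprodHull (A j) ⊆ B j := fun j =>
    coprodHull_minimal ((hB.sub j).isCoprodClosed (hBc j)) (hAB j)
  refine Set.Subset.antisymm (fun X hX => ?_) (hsub i)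
  have hshift : ∀ k, ShiftClosed (coprodHull (tailUnion A k)) := fun k =>
    (isCoprodClosedTriangulatedSub_coprodHull _).shift_mem
  have hmem : ∀ k : ℕ, k ≤ i → X ∈ coprodHull (tailUnion A k) := by
    intro k
    induction k with
    | zero => exact fun _ => mem_coprodHull_tailUnion_zero hgen hA X
    | succ k ih =>
      intro hk
      have hkm : k < m := (Nat.lt_of_succ_le hk).trans i.isLt
      obtain ⟨Y, hY, Z, hZ, u, v, w, hT⟩ :=
        hA.coprodHull_tailUnion_subset_extensions ⟨k, hkm⟩ (ih (Nat.le_of_succ_le hk))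
      obtain ⟨e⟩ := nonempty_iso_obj₁ (hshift _)
        (hA.coprodHull_tailUnion_subset_leftPerp ⟨k, hkm⟩) hY hZ hT fun Z' hZ' f =>
          subset_leftPerp_of_semiorth (hB.semiorth ⟨k, hkm⟩ i hk) hX Z' (hsub _ hZ') f
      exact (isCoprodClosedTriangulatedSub_coprodHull _).iso_closed e hY
  have hperp : coprodHull (tailUnion A (i + 1)) ⊆ leftPerp (B i) :=
    coprodHull_minimal (isCoprodClosedTriangulatedSub_leftPerp (hB.sub i).shift_mem)
      fun Y ⟨j, hj, hY⟩ => subset_leftPerp_of_semiorth (hB.semiorth i j hj) (hAB j hY)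
  obtain ⟨Y, hY, Z, hZ, u, v, w, hT⟩ :=
    hA.coprodHull_tailUnion_subset_extensions i (hmem i le_rfl)
  obtain ⟨e⟩ := nonempty_iso_obj₃ (hshift _) (hA.coprodHull_tailUnion_subset_leftPerp i) hY hZ hT
    fun Y' hY' f => hperp hY' X hX f
  exact (isCoprodClosedTriangulatedSub_coprodHull _).iso_closed e hZ

end IsSODOn

theorem sod_extends_to_coproduct_closure
    (hgen : coprodHull (Compacts : Set C) = Set.univ)
    (m : ℕ) (A : Fin m → Set C) (hA : IsSODOn (Compacts : Set C) m A) :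
    IsSOD m (fun i => coprodHull (A i)) ∧
    (∀ i, CoprodClosed (coprodHull (A i))) ∧
    (∀ i, A i ⊆ coprodHull (A i)) ∧
    (∀ B : Fin m → Set C, IsSOD m B → (∀ i, CoprodClosed (B i)) →
      (∀ i, A i ⊆ B i) → ∀ i, B i = coprodHull (A i)) := by
  exact ⟨hA.isSOD_coprodHull hgen,
    fun i => (isCoprodClosedTriangulatedSub_coprodHull (A i)).coprod_mem,
    fun i => subset_coprodHull (A i), fun B hB hBc hAB => hA.eq_coprodHull hgen hB hBc hAB⟩
end
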